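/- Let f : ℝ^{n×p} → ℝ be twice continuously differentiable with Frobenius gradient ∇f and Hessian map ∇²f, fix λ > 0, and define J(X)[V] := 2·skew(∇²f(X)[V]·Xᵀ + ∇f(X)·Vᵀ)X + 2·skew(∇f(X)Xᵀ)V + λ·V(XᵀX − I_p) + 2λ·X·sym(XᵀV). Suppose X⋆ ∈ ℝ^{n×p} is a stationary point, i.e., X⋆ᵀX⋆ = I_p and skew(∇f(X⋆)X⋆ᵀ) = 0. Then: (i) for every V ∈ ℝ^{n×p}, J(X⋆)[V] = 2·skew(∇²f(X⋆)[V]·X⋆ᵀ + ∇f(X⋆)·Vᵀ)X⋆ + 2λ·X⋆·sym(X⋆ᵀV); (ii) if sym(X⋆ᵀV) = 0 (V tangent), then J(X⋆)[V] = 2·skew(∇²f(X⋆)[V]·X⋆ᵀ + ∇f(X⋆)·Vᵀ)X⋆ and sym(X⋆ᵀ·J(X⋆)[V]) = 0; (iii) if V = X⋆S with S ∈ ℝ^{p×p} symmetric (V normal), then J(X⋆)[V] = 2·skew(∇²f(X⋆)[V]·X⋆ᵀ + ∇f(X⋆)·Vᵀ)X⋆ + 2λ·V. -/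

import Mathlib

open Matrix BigOperators

attribute [local instance] Matrix.frobeniusNormedAddCommGroup Matrix.frobeniusNormedSpace

noncomputable section

/-- Symmetric part of a square matrix. -/
def symPart {m : ℕ} (A : Matrix (Fin m) (Fin m) ℝ) : Matrix (Fin m) (Fin m) ℝ :=
  (1 / 2 : ℝ) • (A + Aᵀ)

/-- Skew-symmetric part of a square matrix. -/
def skewPart {m : ℕ} (A : Matrix (Fin m) (Fin m) ℝ) : Matrix (Fin m) (Fin m) ℝ :=
  (1 / 2 : ℝ) • (A - Aᵀ)

theorem symPart_smul {m : ℕ} (c : ℝ) (A : Matrix (Fin m) (Fin m) ℝ) :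
    symPart (c • A) = c • symPart A := by
  simp only [symPart, transpose_smul, ← smul_add, smul_comm c]

theorem symPart_eq_self {m : ℕ} {A : Matrix (Fin m) (Fin m) ℝ} (hA : Aᵀ = A) :
    symPart A = A := by
  rw [symPart, hA, ← two_smul ℝ A, smul_smul]
  norm_num

/-- A congruence transform of a skew-symmetric matrix is skew-symmetric. -/
theorem symPart_conj_skewPart {n p : ℕ} (X : Matrix (Fin n) (Fin p) ℝ)
    (M : Matrix (Fin n) (Fin n) ℝ) : symPart (Xᵀ * (skewPart M * X)) = 0 := by
  have hM : (skewPart M)ᵀ = -skewPart M := by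
    rw [skewPart, transpose_smul, transpose_sub, transpose_transpose, ← smul_neg, neg_sub]
  rw [symPart, transpose_mul, transpose_mul, hM, transpose_transpose, Matrix.mul_neg,
    Matrix.neg_mul, Matrix.mul_assoc, add_neg_cancel, smul_zero]

/-- At a stationary point `X⋆` (`X⋆ᵀX⋆ = I`, `skew(∇f(X⋆)X⋆ᵀ) = 0`), the Jacobian of the
landing field simplifies and is block upper-triangular: (i) general simplification;
(ii) on tangent vectors it equals the Hessian-type term and stays tangent;
(iii) on normal vectors `V = X⋆S`, `S` symmetric, it is the Hessian-type term plus `2λV`. -/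
theorem landing_jacobian_at_stationary {n p : ℕ}
    (f : Matrix (Fin n) (Fin p) ℝ → ℝ)
    (Gf : Matrix (Fin n) (Fin p) ℝ → Matrix (Fin n) (Fin p) ℝ)
    (Hf : Matrix (Fin n) (Fin p) ℝ → Matrix (Fin n) (Fin p) ℝ →L[ℝ] Matrix (Fin n) (Fin p) ℝ)
    (hf : ContDiff ℝ 2 f)
    (hG : ∀ X V, fderiv ℝ f X V = Matrix.trace ((Gf X)ᵀ * V))
    (hH : ∀ X, HasFDerivAt Gf (Hf X) X)
    (lam : ℝ) (hlam : 0 < lam)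
    (J : Matrix (Fin n) (Fin p) ℝ → Matrix (Fin n) (Fin p) ℝ → Matrix (Fin n) (Fin p) ℝ)
    (hJ : ∀ X V, J X V =
      (2 : ℝ) • skewPart (Hf X V * Xᵀ + Gf X * Vᵀ) * X
      + (2 : ℝ) • skewPart (Gf X * Xᵀ) * V
      + lam • (V * (Xᵀ * X - 1))
      + (2 * lam) • (X * symPart (Xᵀ * V)))
    (Xs : Matrix (Fin n) (Fin p) ℝ)
    (hXs : Xsᵀ * Xs = 1)
    (hstat : skewPart (Gf Xs * Xsᵀ) = 0) :
    (∀ V, J Xs V =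
        (2 : ℝ) • skewPart (Hf Xs V * Xsᵀ + Gf Xs * Vᵀ) * Xs
        + (2 * lam) • (Xs * symPart (Xsᵀ * V)))
    ∧ (∀ V, symPart (Xsᵀ * V) = 0 →
        J Xs V = (2 : ℝ) • skewPart (Hf Xs V * Xsᵀ + Gf Xs * Vᵀ) * Xs
        ∧ symPart (Xsᵀ * J Xs V) = 0)
    ∧ (∀ S : Matrix (Fin p) (Fin p) ℝ, Sᵀ = S →
        J Xs (Xs * S) =
          (2 : ℝ) • skewPart (Hf Xs (Xs * S) * Xsᵀ + Gf Xs * (Xs * S)ᵀ) * Xs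
          + (2 * lam) • (Xs * S)) := by
  have hi : ∀ V, J Xs V =
      (2 : ℝ) • skewPart (Hf Xs V * Xsᵀ + Gf Xs * Vᵀ) * Xs
      + (2 * lam) • (Xs * symPart (Xsᵀ * V)) := fun V => by
    rw [hJ, hstat, hXs]
    simp
  refine ⟨hi, fun V hV => ?_, fun S hS => ?_⟩
  · have hJV : J Xs V = (2 : ℝ) • skewPart (Hf Xs V * Xsᵀ + Gf Xs * Vᵀ) * Xs := by
      rw [hi, hV]
      simp
    refine ⟨hJV, ?_⟩
    rw [hJV, Matrix.smul_mul, Matrix.mul_smul, symPart_smul,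
      symPart_conj_skewPart, smul_zero]
  · rw [hi, ← Matrix.mul_assoc Xsᵀ, hXs, Matrix.one_mul, symPart_eq_self hS]
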